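/- Truncation and renormalization do not affect the cut-off log-determinant: lim_{n→∞} sup_{y ∈ ℝ^m} E_z| (1/n) Σ_{i=1}^{n−1} ln_{ε_n}|λ_i(H_n^Λ(y))| − (1/n) Σ_{i=1}^{n−1} ln_{ε_n}|λ_i(H̃_n^Λ(y))| | = 0, where ε_n = n^{−δ} and λ_i(·) denote the eigenvalues. -/

import Mathlib

/- STATEMENT 12: truncation and renormalization of the Gaussian entries do not affect
the cut-off log-determinant (Lemma A.10 of the paper): with ε_n = n^{−δ},
 lim_n sup_{y∈ℝ^m} E_z |(1/n)∑_i ln_{ε_n}|λ_i(H_n^Λ(y))|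
        − (1/n)∑_i ln_{ε_n}|λ_i(H̃_n^Λ(y))|| = 0,
rendered as: for every ε > 0, eventually in n, the expectation is < ε for all y. -/


open MeasureTheory Matrix Filter Topology Real Set ProbabilityTheory
open scoped ENNReal NNReal Classical

noncomputable section

abbrev stdGauss : Measure ℝ := gaussianReal 0 1

def gaussVec (k : ℕ) : Measure (Fin k → ℝ) := Measure.pi fun _ => stdGauss

def gaussMat (a b : ℕ) : Measure (Fin a → Fin b → ℝ) :=
  Measure.pi fun _ => Measure.pi fun _ => stdGauss

def Pperp (φ : ℝ → ℝ) {m : ℕ} (y : Fin m → ℝ) : Matrix (Fin m) (Fin m) ℝ :=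
  1 - Matrix.of (fun μ ν => deriv φ (y μ) * deriv φ (y ν) / ∑ ρ, (deriv φ (y ρ)) ^ 2)

def Dmat (φ : ℝ → ℝ) (n : ℕ) {m : ℕ} (y : Fin m → ℝ) : Matrix (Fin m) (Fin m) ℝ :=
  Matrix.diagonal fun μ => ((n : ℝ) / m) * deriv (deriv φ) (y μ)

def Lam (φ : ℝ → ℝ) (n : ℕ) {m : ℕ} (y : Fin m → ℝ) : Matrix (Fin m) (Fin m) ℝ :=
  Pperp φ y * Dmat φ n y * Pperp φ y

def Hmat (φ : ℝ → ℝ) (n : ℕ) {m : ℕ} (y : Fin m → ℝ)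
    (z : Fin (n - 1) → Fin m → ℝ) : Matrix (Fin (n - 1)) (Fin (n - 1)) ℝ :=
  ((n : ℝ)⁻¹) • (Matrix.of z * Lam φ n y * (Matrix.of z)ᵀ) -
    ((1 / (m : ℝ)) * ∑ μ, y μ * deriv φ (y μ)) • 1

/-- `E_z |det H_n^Λ(y)|`. -/
def Edet (φ : ℝ → ℝ) (n m : ℕ) (y : Fin m → ℝ) : ℝ :=
  ∫ z, |Matrix.det (Hmat φ n y z)| ∂(gaussMat (n - 1) m)


/-- Eigenvalues of a (Hermitian) real matrix; junk value `0` otherwise. -/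
def eigs {k : ℕ} (M : Matrix (Fin k) (Fin k) ℝ) : Fin k → ℝ :=
  if h : M.IsHermitian then h.eigenvalues else 0

/-- `Tr f(M) = ∑_i f(λ_i(M))`. -/
def trF {k : ℕ} (f : ℝ → ℝ) (M : Matrix (Fin k) (Fin k) ℝ) : ℝ :=
  ∑ i, f (eigs M i)

/-- The truncation normalizer `E[z² 1{|z| ≤ c}]`. -/
def truncNorm (c : ℝ) : ℝ := ∫ x in {x : ℝ | |x| ≤ c}, x ^ 2 ∂stdGauss

/-- Truncated and renormalized entry `z̃ = z 1{|z| ≤ c} / (E[z² 1{|z| ≤ c}])^{1/2}`. -/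
def trunc (c v : ℝ) : ℝ := (if |v| ≤ c then v else 0) / Real.sqrt (truncNorm c)


/-- `ln_ε |x| = ln (max (|x|, ε))`. -/
def lnEps (ε x : ℝ) : ℝ := Real.log (max |x| ε)

lemma abs_lnEps_le {e : ℝ} (he : 0 < e) (he1 : e ≤ 1) (x : ℝ) :
    |lnEps e x| ≤ e⁻¹ + |x| := by
  have h0 : 0 < max |x| e := lt_max_of_lt_right he
  have h1 : Real.log e ≤ Real.log (max |x| e) := Real.log_le_log he (le_max_right _ _)
  have h2 := Real.log_le_sub_one_of_pos h0
  have h3 : max |x| e ≤ |x| + 1 := max_le (by linarith) (by linarith [abs_nonneg x])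
  have h4 := Real.log_le_sub_one_of_pos (inv_pos.2 he)
  rw [Real.log_inv] at h4
  have h5 : 0 < e⁻¹ := inv_pos.2 he
  have h6 := abs_nonneg x
  unfold lnEps
  rw [abs_le]
  constructor <;> linarith

lemma abs_log_sub_log_le {e u v : ℝ} (he : 0 < e) (hu : e ≤ u) (hv : e ≤ v) :
    |Real.log u - Real.log v| ≤ |u - v| / e := by
  wlog h : v ≤ u generalizing u v
  · rw [abs_sub_comm, abs_sub_comm u]
    exact this hv hu (le_of_not_ge h)
  have hu0 : 0 < u := he.trans_le hu
  have hv0 : 0 < v := he.trans_le hv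
  rw [abs_of_nonneg (sub_nonneg.2 (Real.log_le_log hv0 h)), abs_of_nonneg (sub_nonneg.2 h),
    ← Real.log_div hu0.ne' hv0.ne']
  calc Real.log (u / v) ≤ u / v - 1 := Real.log_le_sub_one_of_pos (div_pos hu0 hv0)
    _ = (u - v) / v := by field_simp
    _ ≤ (u - v) / e := div_le_div_of_nonneg_left (sub_nonneg.2 h) he hv

lemma abs_lnEps_sub_lnEps_le {e : ℝ} (he : 0 < e) (x y : ℝ) :
    |lnEps e x - lnEps e y| ≤ |x - y| / e := by
  refine (abs_log_sub_log_le he (le_max_right _ _) (le_max_right _ _)).trans ?_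
  exact div_le_div_of_nonneg_right
    ((abs_max_sub_max_le_abs |x| |y| e).trans (abs_abs_sub_abs_le x y)) he.le

lemma abs_eigs_le_sum {k : ℕ} (M : Matrix (Fin k) (Fin k) ℝ) (i : Fin k) :
    |eigs M i| ≤ ∑ a, ∑ b, |M a b| := by
  unfold eigs
  split_ifs with h
  · have hv := h.mulVec_eigenvectorBasis i
    set v : Fin k → ℝ := ⇑(h.eigenvectorBasis i) with hvdef
    obtain ⟨j, -, hj⟩ := Finset.exists_max_image Finset.univ (fun j => |v j|) ⟨i, Finset.mem_univ i⟩
    have hvj : 0 < |v j| := by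
      rcases (abs_nonneg (v j)).lt_or_eq with h0 | h0
      · exact h0
      · exfalso
        have hz : h.eigenvectorBasis i = 0 := by
          ext a
          have := hj a (Finset.mem_univ a)
          rw [← h0] at this
          exact abs_nonpos_iff.1 this
        have h1 := h.eigenvectorBasis.orthonormal.1 i
        rw [hz] at h1
        simp at h1
    have hrow : |h.eigenvalues i| * |v j| ≤ (∑ b, |M j b|) * |v j| := by
      have := congrFun hv j
      rw [← abs_mul]
      change (M *ᵥ v) j = h.eigenvalues i * v j at this
      rw [← this, Matrix.mulVec, dotProduct, Finset.sum_mul]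
      refine (Finset.abs_sum_le_sum_abs _ _).trans (Finset.sum_le_sum fun b _ => ?_)
      rw [abs_mul]
      exact mul_le_mul_of_nonneg_left (hj b (Finset.mem_univ b)) (abs_nonneg _)
    refine (le_of_mul_le_mul_right hrow hvj).trans ?_
    exact Finset.single_le_sum (f := fun a => ∑ b, |M a b|)
      (fun a _ => Finset.sum_nonneg fun b _ => abs_nonneg _) (Finset.mem_univ j)
  · simpa using Finset.sum_nonneg fun a _ => Finset.sum_nonneg fun b _ => abs_nonneg (M a b)

lemma sum_eigs_smul_add_smul_one {k : ℕ} {M : Matrix (Fin k) (Fin k) ℝ} (hM : M.IsHermitian)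
    (a b : ℝ) (f : ℝ → ℝ) :
    ∑ i, f (eigs (a • M + b • 1) i) = ∑ i, f (a * eigs M i + b) := by
  have hN : (a • M + b • (1 : Matrix (Fin k) (Fin k) ℝ)).IsHermitian := by
    refine Matrix.IsHermitian.add ?_ ?_
    · simp only [Matrix.IsHermitian, Matrix.conjTranspose_smul, star_trivial, hM.eq]
    · simp [Matrix.IsHermitian]
  have hcfc : cfc (fun x : ℝ => a * x + b) M = a • M + b • 1 := by
    rw [cfc_add_const b (fun x : ℝ => a * x) M (by fun_prop), cfc_const_mul_id a M,
      Algebra.algebraMap_eq_smul_one]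
  have hroots := hN.roots_charpoly_eq_eigenvalues
  have hchar : (a • M + b • (1 : Matrix (Fin k) (Fin k) ℝ)).charpoly = _ :=
    hcfc ▸ hM.charpoly_cfc_eq fun x : ℝ => a * x + b
  rw [hchar, Polynomial.roots_prod _ _
    (Finset.prod_ne_zero_iff.2 fun i _ => Polynomial.X_sub_C_ne_zero _)] at hroots
  simp only [Polynomial.roots_X_sub_C, Multiset.bind_singleton] at hroots
  have := congrArg (fun s => (s.map f).sum) hroots
  simp only [Multiset.map_map, Function.comp_def] at this
  rw [eigs, eigs, dif_pos hN, dif_pos hM]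
  exact this.symm

section ProjectedWeights

variable {φ : ℝ → ℝ} {n m : ℕ} {K : ℝ} (y : Fin m → ℝ)

lemma isHermitian_Lam : (Lam φ n y).IsHermitian := by
  have hP : (Pperp φ y)ᴴ = Pperp φ y := by
    ext i j
    simp [Pperp, Matrix.one_apply, eq_comm, mul_comm]
  rw [Matrix.IsHermitian, Lam, Matrix.conjTranspose_mul, Matrix.conjTranspose_mul, hP, Dmat,
    Matrix.diagonal_conjTranspose, star_trivial, Matrix.mul_assoc]

lemma isHermitian_Hmat (z : Fin (n - 1) → Fin m → ℝ) : (Hmat φ n y z).IsHermitian := by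
  refine Matrix.IsHermitian.sub ?_ ?_
  · have := Matrix.isHermitian_mul_mul_conjTranspose (Matrix.of z)
      (isHermitian_Lam (φ := φ) (n := n) y)
    rw [Matrix.conjTranspose_eq_transpose_of_trivial] at this
    simp only [Matrix.IsHermitian, Matrix.conjTranspose_smul, star_trivial, this.eq]
  · simp [Matrix.IsHermitian]

lemma abs_Pperp_le (i j : Fin m) : |Pperp φ y i j| ≤ 2 := by
  have h1 : |(1 : Matrix (Fin m) (Fin m) ℝ) i j| ≤ 1 := by
    rw [Matrix.one_apply]; split_ifs <;> simp
  have h2 : |deriv φ (y i) * deriv φ (y j) / ∑ ρ, (deriv φ (y ρ)) ^ 2| ≤ 1 := by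
    have hs : ∀ a, deriv φ (y a) ^ 2 ≤ ∑ ρ, deriv φ (y ρ) ^ 2 := fun a =>
      Finset.single_le_sum (f := fun ρ => deriv φ (y ρ) ^ 2) (fun ρ _ => sq_nonneg _)
        (Finset.mem_univ a)
    have hi := hs i
    have hj := hs j
    rw [abs_div, abs_mul, abs_of_nonneg ((sq_nonneg _).trans hi)]
    refine div_le_one_of_le₀ ?_ ((sq_nonneg _).trans hi)
    rw [← sq_abs] at hi hj
    nlinarith [sq_nonneg (|deriv φ (y i)| - |deriv φ (y j)|)]
  calc |Pperp φ y i j| ≤ _ := by simpa [Pperp] using abs_sub _ _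
    _ ≤ 1 + 1 := add_le_add h1 h2
    _ = 2 := by norm_num

lemma abs_Lam_le (hK : ∀ x, |deriv (deriv φ) x| ≤ K) (i j : Fin m) :
    |Lam φ n y i j| ≤ 4 * K * n := by
  have hm : (0 : ℝ) < m := by
    have := i.pos
    exact_mod_cast this
  rw [Lam, Dmat, Matrix.mul_apply]
  simp only [Matrix.mul_diagonal]
  have hK0 : 0 ≤ K := (abs_nonneg _).trans (hK 0)
  calc _ ≤ ∑ _k : Fin m, 2 * ((n : ℝ) / m * K) * 2 := by
        refine (Finset.abs_sum_le_sum_abs _ _).trans (Finset.sum_le_sum fun k _ => ?_)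
        rw [abs_mul, abs_mul, abs_mul, abs_of_nonneg (by positivity : (0 : ℝ) ≤ (n : ℝ) / m)]
        gcongr
        · exact abs_Pperp_le y i k
        · exact hK _
        · exact abs_Pperp_le y k j
    _ = 4 * K * n := by
        rw [Finset.sum_const, Finset.card_univ, Fintype.card_fin, nsmul_eq_mul]
        field_simp
        ring

lemma abs_average_le (hK : ∀ x, |x * deriv φ x| ≤ K) :
    |1 / (m : ℝ) * ∑ μ, y μ * deriv φ (y μ)| ≤ K := by
  have hK0 : 0 ≤ K := (abs_nonneg _).trans (hK 0)
  rw [abs_mul, abs_of_nonneg (by positivity)]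
  have : |∑ μ, y μ * deriv φ (y μ)| ≤ m * K := by
    refine (Finset.abs_sum_le_sum_abs _ _).trans ((Finset.sum_le_sum fun μ _ => hK (y μ)).trans ?_)
    simp
  rcases Nat.eq_zero_or_pos m with rfl | hm
  · simpa using hK0
  · have : (0 : ℝ) < m := by exact_mod_cast hm
    rw [one_div, inv_mul_le_iff₀ this]
    assumption

lemma abs_mul_mul_transpose_le {k : ℕ} {L : Matrix (Fin m) (Fin m) ℝ} {B : ℝ} (hB : 0 ≤ B)
    (hL : ∀ i j, |L i j| ≤ B) (z : Fin k → Fin m → ℝ) (a b : Fin k) :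
    |(Matrix.of z * L * (Matrix.of z)ᵀ) a b| ≤ B * m * ∑ i, ∑ μ, z i μ ^ 2 := by
  have hrow : ∀ a, ∑ μ, z a μ ^ 2 ≤ ∑ i, ∑ μ, z i μ ^ 2 := fun a =>
    Finset.single_le_sum (f := fun i => ∑ μ, z i μ ^ 2)
      (fun i _ => Finset.sum_nonneg fun μ _ => sq_nonneg _) (Finset.mem_univ a)
  have ha := hrow a
  have hb := hrow b
  calc |(Matrix.of z * L * (Matrix.of z)ᵀ) a b|
      ≤ ∑ ν, ∑ μ, B * ((z a μ ^ 2 + z b ν ^ 2) / 2) := by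
        rw [Matrix.mul_apply]
        refine (Finset.abs_sum_le_sum_abs _ _).trans (Finset.sum_le_sum fun ν _ => ?_)
        rw [Matrix.mul_apply, Finset.sum_mul]
        refine (Finset.abs_sum_le_sum_abs _ _).trans (Finset.sum_le_sum fun μ _ => ?_)
        simp only [Matrix.of_apply, Matrix.transpose_apply, abs_mul]
        have h1 : |z a μ| * |z b ν| ≤ (z a μ ^ 2 + z b ν ^ 2) / 2 := by
          rw [← sq_abs (z a μ), ← sq_abs (z b ν)]
          nlinarith [sq_nonneg (|z a μ| - |z b ν|)]
        calc |z a μ| * |L μ ν| * |z b ν| = |L μ ν| * (|z a μ| * |z b ν|) := by ring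
          _ ≤ _ := mul_le_mul (hL μ ν) h1 (by positivity) hB
    _ = B * (m * ((∑ μ, z a μ ^ 2 + ∑ μ, z b μ ^ 2) / 2)) := by
        simp only [← Finset.mul_sum, ← Finset.sum_div, Finset.sum_add_distrib, Finset.sum_const,
          Finset.card_univ, Fintype.card_fin, nsmul_eq_mul]
        ring
    _ ≤ B * (m * ∑ i, ∑ μ, z i μ ^ 2) := by
        gcongr
        linarith
    _ = _ := by ring

lemma abs_eigs_Hmat_le (hn : 1 ≤ n) (hK1 : ∀ x, |x * deriv φ x| ≤ K)
    (hK2 : ∀ x, |deriv (deriv φ) x| ≤ K) (z : Fin (n - 1) → Fin m → ℝ) (i : Fin (n - 1)) :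
    |eigs (Hmat φ n y z) i| ≤ 4 * K * n ^ 2 * (m + 1) * (1 + ∑ i, ∑ μ, z i μ ^ 2) := by
  have hK0 : 0 ≤ K := (abs_nonneg _).trans (hK2 0)
  have hn0 : (0 : ℝ) < n := by exact_mod_cast hn
  have hn1 : ((n - 1 : ℕ) : ℝ) ≤ n := by exact_mod_cast Nat.sub_le n 1
  set S : ℝ := ∑ i, ∑ μ, z i μ ^ 2 with hS
  have hS0 : 0 ≤ S := Finset.sum_nonneg fun i _ => Finset.sum_nonneg fun μ _ => sq_nonneg _
  have hentry : ∀ a b, |Hmat φ n y z a b| ≤ 4 * K * (m + 1) * (1 + S) := by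
    intro a b
    have h1 := abs_mul_mul_transpose_le (by positivity) (abs_Lam_le (n := n) y hK2) z a b
    have h2 := abs_average_le y hK1
    have h3 : |(1 : Matrix (Fin (n - 1)) (Fin (n - 1)) ℝ) a b| ≤ 1 := by
      rw [Matrix.one_apply]; split_ifs <;> simp
    rw [Hmat, Matrix.sub_apply, Matrix.smul_apply, Matrix.smul_apply, smul_eq_mul, smul_eq_mul]
    refine (abs_sub _ _).trans ?_
    rw [abs_mul, abs_mul, abs_of_pos (inv_pos.2 hn0)]
    calc _ ≤ (n : ℝ)⁻¹ * (4 * K * n * m * S) + K * 1 := by gcongr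
      _ = 4 * K * m * S + K := by field_simp
      _ ≤ _ := by nlinarith [mul_nonneg hK0 hS0, mul_nonneg hK0 (Nat.cast_nonneg (α := ℝ) m)]
  refine (abs_eigs_le_sum _ i).trans ?_
  calc _ ≤ ∑ _a : Fin (n - 1), ∑ _b : Fin (n - 1), 4 * K * (m + 1) * (1 + S) :=
        Finset.sum_le_sum fun a _ => Finset.sum_le_sum fun b _ => hentry a b
    _ = ((n - 1 : ℕ) : ℝ) * ((n - 1 : ℕ) : ℝ) * (4 * K * (m + 1) * (1 + S)) := by
        simp only [Finset.sum_const, Finset.card_univ, Fintype.card_fin, nsmul_eq_mul]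
        ring
    _ ≤ (n : ℝ) * n * (4 * K * (m + 1) * (1 + S)) := by gcongr
    _ = _ := by ring

lemma Hmat_const_mul (s : ℝ) (z : Fin (n - 1) → Fin m → ℝ) :
    Hmat φ n y (fun i μ => s * z i μ) = (s ^ 2) • Hmat φ n y z +
      ((s ^ 2 - 1) * (1 / (m : ℝ) * ∑ μ, y μ * deriv φ (y μ))) • 1 := by
  have : (Matrix.of fun i μ => s * z i μ) = s • Matrix.of z := by
    ext; simp
  rw [Hmat, Hmat, this, Matrix.transpose_smul, Matrix.smul_mul, Matrix.smul_mul, Matrix.mul_smul]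
  simp only [smul_sub, smul_smul]
  rw [sub_mul, sub_smul, one_mul]
  rw [show (n : ℝ)⁻¹ * (s * s) = s ^ 2 * (n : ℝ)⁻¹ by ring]
  abel

end ProjectedWeights

section PointwiseBounds

variable {φ : ℝ → ℝ} {n m : ℕ} {K e : ℝ} (y : Fin m → ℝ)

lemma abs_average_fin_pred_le {B : ℝ} (hn : 1 ≤ n) (hB : 0 ≤ B) {f : Fin (n - 1) → ℝ}
    (hf : ∀ i, |f i| ≤ B) : |1 / (n : ℝ) * ∑ i, f i| ≤ B := by
  have hn0 : (0 : ℝ) < n := by exact_mod_cast hn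
  have hn1 : ((n - 1 : ℕ) : ℝ) ≤ n := by exact_mod_cast Nat.sub_le n 1
  rw [abs_mul, abs_of_pos (by positivity), one_div, inv_mul_le_iff₀ hn0]
  refine (Finset.abs_sum_le_sum_abs _ _).trans ((Finset.sum_le_sum fun i _ => hf i).trans ?_)
  rw [Finset.sum_const, Finset.card_univ, Fintype.card_fin, nsmul_eq_mul]
  gcongr

lemma abs_average_lnEps_eigs_Hmat_le (hn : 1 ≤ n) (he : 0 < e) (he1 : e ≤ 1) (hen : e⁻¹ ≤ n)
    (hK1 : ∀ x, |x * deriv φ x| ≤ K) (hK2 : ∀ x, |deriv (deriv φ) x| ≤ K)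
    (z : Fin (n - 1) → Fin m → ℝ) :
    |1 / (n : ℝ) * ∑ i, lnEps e (eigs (Hmat φ n y z) i)| ≤
      n + 4 * K * n ^ 2 * (m + 1) * (1 + ∑ i, ∑ μ, z i μ ^ 2) := by
  have hK0 : 0 ≤ K := (abs_nonneg _).trans (hK2 0)
  exact abs_average_fin_pred_le hn (by positivity) fun i =>
    (abs_lnEps_le he he1 _).trans (add_le_add hen (abs_eigs_Hmat_le y hn hK1 hK2 z i))

lemma abs_average_lnEps_sub_le_of_const_mul (hn : 1 ≤ n) (he : 0 < e) (hen : e⁻¹ ≤ n)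
    (hK1 : ∀ x, |x * deriv φ x| ≤ K) (hK2 : ∀ x, |deriv (deriv φ) x| ≤ K)
    (s : ℝ) (z : Fin (n - 1) → Fin m → ℝ) :
    |1 / (n : ℝ) * ∑ i, lnEps e (eigs (Hmat φ n y z) i) -
        1 / (n : ℝ) * ∑ i, lnEps e (eigs (Hmat φ n y fun i μ => s * z i μ) i)| ≤
      |s ^ 2 - 1| * (n * (4 * K * n ^ 2 * (m + 1) * (1 + ∑ i, ∑ μ, z i μ ^ 2) + K)) := by
  have hK0 : 0 ≤ K := (abs_nonneg _).trans (hK2 0)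
  rw [Hmat_const_mul, sum_eigs_smul_add_smul_one (isHermitian_Hmat y z), ← mul_sub,
    ← Finset.sum_sub_distrib]
  refine abs_average_fin_pred_le hn (by positivity) fun i => ?_
  refine (abs_lnEps_sub_lnEps_le he _ _).trans ?_
  have h1 := abs_eigs_Hmat_le y hn hK1 hK2 z i
  have h2 := abs_average_le y hK1
  set c := 1 / (m : ℝ) * ∑ μ, y μ * deriv φ (y μ)
  set l := eigs (Hmat φ n y z) i
  rw [show l - (s ^ 2 * l + (s ^ 2 - 1) * c) = -((s ^ 2 - 1) * (l + c)) by ring, abs_neg, abs_mul,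
    div_eq_mul_inv, mul_assoc, mul_comm |l + c|]
  gcongr
  exact (abs_add_le _ _).trans (add_le_add h1 h2)

lemma one_add_sum_sq_le {a b p : ℕ} {c : ℝ} (hc : 1 ≤ c) (z : Fin a → Fin b → ℝ)
    (hz : ∃ i μ, c < |z i μ|) :
    1 + ∑ i, ∑ μ, z i μ ^ 2 ≤
      2 * (a * b) * ∑ i, ∑ μ, z i μ ^ (2 * (p + 1)) / c ^ (2 * p) := by
  obtain ⟨i₀, μ₀, h₀⟩ := hz
  obtain ⟨⟨i₁, μ₁⟩, -, hmax⟩ := Finset.exists_max_image (Finset.univ : Finset (Fin a × Fin b))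
    (fun x => |z x.1 x.2|) ⟨(i₀, μ₀), Finset.mem_univ _⟩
  set t := |z i₁ μ₁|
  have ht : c < t := h₀.trans_le (hmax (i₀, μ₀) (Finset.mem_univ _))
  have ht1 : 1 ≤ t ^ 2 := one_le_pow₀ (hc.trans ht.le)
  have hab : (1 : ℝ) ≤ a * b := by
    have h1 := i₀.pos
    have h2 := μ₀.pos
    exact_mod_cast Nat.mul_pos h1 h2
  have hS : ∑ i, ∑ μ, z i μ ^ 2 ≤ a * b * t ^ 2 := by
    calc _ ≤ ∑ _i : Fin a, ∑ _μ : Fin b, t ^ 2 := by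
          refine Finset.sum_le_sum fun i _ => Finset.sum_le_sum fun μ _ => ?_
          rw [← sq_abs]
          exact pow_le_pow_left₀ (abs_nonneg _) (hmax (i, μ) (Finset.mem_univ _)) 2
      _ = _ := by simp; ring
  have hnn : ∀ i μ, 0 ≤ z i μ ^ (2 * (p + 1)) / c ^ (2 * p) := fun i μ => by
    rw [pow_mul]; positivity
  have hW : t ^ 2 ≤ ∑ i, ∑ μ, z i μ ^ (2 * (p + 1)) / c ^ (2 * p) := by
    calc t ^ 2 ≤ t ^ (2 * (p + 1)) / c ^ (2 * p) := by
          rw [le_div_iff₀ (by positivity), show 2 * (p + 1) = 2 + 2 * p by ring, pow_add]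
          gcongr
      _ = z i₁ μ₁ ^ (2 * (p + 1)) / c ^ (2 * p) := by
          rw [pow_mul, pow_mul (z i₁ μ₁), sq_abs]
      _ ≤ ∑ μ, z i₁ μ ^ (2 * (p + 1)) / c ^ (2 * p) :=
          Finset.single_le_sum (f := fun μ => z i₁ μ ^ (2 * (p + 1)) / c ^ (2 * p))
            (fun μ _ => hnn i₁ μ) (Finset.mem_univ μ₁)
      _ ≤ _ := Finset.single_le_sum (f := fun i => ∑ μ, z i μ ^ (2 * (p + 1)) / c ^ (2 * p))
            (fun i _ => Finset.sum_nonneg fun μ _ => hnn i μ) (Finset.mem_univ i₁)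
  calc 1 + ∑ i, ∑ μ, z i μ ^ 2 ≤ 2 * (a * b) * t ^ 2 := by nlinarith
    _ ≤ _ := by gcongr

lemma abs_trunc_le (c v : ℝ) : |trunc c v| ≤ |v| / Real.sqrt (truncNorm c) := by
  rw [trunc, abs_div, abs_of_nonneg (Real.sqrt_nonneg _)]
  refine div_le_div_of_nonneg_right ?_ (Real.sqrt_nonneg _)
  split_ifs
  · exact le_rfl
  · simp

/-- Off the truncation event the two matrices are affinely related; on it, one entry exceeds the
threshold `c` and a crude bound paid for by high moments is enough. -/
lemma abs_average_lnEps_trunc_sub_le (p : ℕ) {c : ℝ} (hc : 1 ≤ c) (hs : 1 / 2 ≤ truncNorm c)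
    (hs1 : truncNorm c ≤ 1) (hn : 1 ≤ n) (he : 0 < e) (he1 : e ≤ 1) (hen : e⁻¹ ≤ n)
    (hK1 : ∀ x, |x * deriv φ x| ≤ K) (hK2 : ∀ x, |deriv (deriv φ) x| ≤ K)
    (z : Fin (n - 1) → Fin m → ℝ) :
    |1 / (n : ℝ) * ∑ i, lnEps e (eigs (Hmat φ n y z) i) -
        1 / (n : ℝ) * ∑ i, lnEps e (eigs (Hmat φ n y fun i μ => trunc c (z i μ)) i)| ≤
      (1 - truncNorm c) * (20 * K * n ^ 3 * (m + 1)) * (1 + ∑ i, ∑ μ, z i μ ^ 2) +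
      (2 * n + 12 * K * n ^ 2 * (m + 1)) * (2 * (n * m)) *
        ∑ i, ∑ μ, z i μ ^ (2 * (p + 1)) / c ^ (2 * p) := by
  have hK0 : 0 ≤ K := (abs_nonneg _).trans (hK2 0)
  have hn0 : (1 : ℝ) ≤ n := by exact_mod_cast hn
  have hn1 : ((n - 1 : ℕ) : ℝ) ≤ n := by exact_mod_cast Nat.sub_le n 1
  have hs0 : 0 < truncNorm c := by linarith
  set s := truncNorm c with hsdef
  set S : ℝ := ∑ i, ∑ μ, z i μ ^ 2 with hS
  have hS0 : 0 ≤ S := Finset.sum_nonneg fun i _ => Finset.sum_nonneg fun μ _ => sq_nonneg _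
  set W : ℝ := ∑ i, ∑ μ, z i μ ^ (2 * (p + 1)) / c ^ (2 * p) with hW
  have hW0 : 0 ≤ W := Finset.sum_nonneg fun i _ => Finset.sum_nonneg fun μ _ => by
    rw [pow_mul]; positivity
  have hsq : (Real.sqrt s)⁻¹ ^ 2 = s⁻¹ := by rw [inv_pow, Real.sq_sqrt hs0.le]
  have hsinv : s⁻¹ ≤ 2 := by
    rw [inv_le_comm₀ hs0 two_pos]; linarith
  by_cases hz : ∃ i μ, c < |z i μ|
  · have h1 := abs_average_lnEps_eigs_Hmat_le y hn he he1 hen hK1 hK2 z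
    have h2 := abs_average_lnEps_eigs_Hmat_le y hn he he1 hen hK1 hK2
      fun i μ => trunc c (z i μ)
    have hS' : ∑ i, ∑ μ, trunc c (z i μ) ^ 2 ≤ 2 * S := by
      rw [hS, Finset.mul_sum]
      refine Finset.sum_le_sum fun i _ => ?_
      rw [Finset.mul_sum]
      refine Finset.sum_le_sum fun μ _ => ?_
      rw [← sq_abs]
      calc |trunc c (z i μ)| ^ 2 ≤ (|z i μ| / Real.sqrt s) ^ 2 :=
            pow_le_pow_left₀ (abs_nonneg _) (abs_trunc_le c _) 2
        _ = s⁻¹ * z i μ ^ 2 := by rw [div_eq_mul_inv, mul_pow, hsq, sq_abs, mul_comm]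
        _ ≤ 2 * z i μ ^ 2 := by gcongr
    have hbad : 1 + S ≤ 2 * (n * m) * W :=
      (one_add_sum_sq_le (p := p) hc z hz).trans (by gcongr)
    set Q := 4 * K * (n : ℝ) ^ 2 * (m + 1) with hQ
    have hQ0 : 0 ≤ Q := by positivity
    have h3 : Q * (1 + ∑ i, ∑ μ, trunc c (z i μ) ^ 2) ≤ Q * (1 + 2 * S) := by gcongr
    have hpos : 0 ≤ (1 - s) * (20 * K * n ^ 3 * (m + 1)) * (1 + S) :=
      mul_nonneg (mul_nonneg (by linarith) (by positivity)) (by positivity)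
    have h4 : (2 * n + 3 * Q) * (1 + S) ≤ (2 * n + 3 * Q) * (2 * (n * m) * W) := by gcongr
    have h5 : (2 * n + 12 * K * (n : ℝ) ^ 2 * (m + 1)) * (2 * (n * m)) * W
        = (2 * n + 3 * Q) * (2 * (n * m) * W) := by rw [hQ]; ring
    rw [h5]
    refine (abs_sub _ _).trans ?_
    nlinarith [mul_nonneg hQ0 hS0, mul_nonneg (zero_le_one.trans hn0) hS0]
  · push Not at hz
    have htr : (fun i μ => trunc c (z i μ)) = fun i μ => (Real.sqrt s)⁻¹ * z i μ := by
      ext i μ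
      rw [trunc, if_pos (hz i μ), div_eq_inv_mul]
    rw [htr]
    refine (abs_average_lnEps_sub_le_of_const_mul y hn he hen hK1 hK2 _ z).trans ?_
    have h1 : |(Real.sqrt s)⁻¹ ^ 2 - 1| ≤ (1 - s) * 2 := by
      rw [hsq, abs_of_nonneg (sub_nonneg.2 ((one_le_inv₀ hs0).2 hs1)),
        show s⁻¹ - 1 = (1 - s) * s⁻¹ by field_simp]
      exact mul_le_mul_of_nonneg_left hsinv (by linarith)
    have h2 : n * (4 * K * (n : ℝ) ^ 2 * (m + 1) * (1 + S) + K)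
        ≤ n * (5 * K * (n : ℝ) ^ 2 * (m + 1) * (1 + S)) := by
      gcongr
      have : K * 1 ≤ K * ((n : ℝ) ^ 2 * (m + 1) * (1 + S)) := by
        gcongr
        exact one_le_mul_of_one_le_of_one_le (one_le_mul_of_one_le_of_one_le (one_le_pow₀ hn0)
          (by linarith [Nat.cast_nonneg (α := ℝ) m])) (by linarith)
      linarith
    have h3 := mul_le_mul h1 h2 (by positivity) (by linarith)
    have h4 : 0 ≤ (2 * n + 12 * K * (n : ℝ) ^ 2 * (m + 1)) * (2 * (n * m)) * W := by positivity
    have h5 : 0 ≤ (1 - s) * (K * (n : ℝ) ^ 3 * (m + 1) * (1 + S)) :=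
      mul_nonneg (by linarith) (by positivity)
    calc _ ≤ _ := h3
      _ = (1 - s) * (10 * K * n ^ 3 * (m + 1)) * (1 + S) := by ring
      _ ≤ _ := by linarith

end PointwiseBounds

section GaussianMoments

lemma integrable_even_pow_stdGauss (k : ℕ) : Integrable (fun x : ℝ => x ^ (2 * k)) stdGauss := by
  refine ((memLp_id_gaussianReal (μ := 0) (v := 1) ((2 * k : ℕ) : ℝ≥0)).integrable_norm_pow').congr
    (ae_of_all _ fun x => ?_)
  simp [pow_mul]

lemma integral_sq_stdGauss : ∫ x : ℝ, x ^ 2 ∂stdGauss = 1 := by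
  have h := variance_of_integral_eq_zero (μ := stdGauss) (X := id) aemeasurable_id
    (by simp [integral_id_gaussianReal])
  rw [variance_id_gaussianReal] at h
  simpa using h.symm

instance isProbabilityMeasure_gaussMat (a b : ℕ) : IsProbabilityMeasure (gaussMat a b) :=
  inferInstanceAs (IsProbabilityMeasure (Measure.pi fun _ => Measure.pi fun _ => stdGauss))

lemma measurePreserving_gaussMat_eval {a b : ℕ} (i : Fin a) (μ : Fin b) :
    MeasurePreserving (fun z : Fin a → Fin b → ℝ => z i μ) (gaussMat a b) stdGauss :=
  (measurePreserving_eval (fun _ : Fin b => stdGauss) μ).comp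
    (measurePreserving_eval (fun _ : Fin a => Measure.pi fun _ : Fin b => stdGauss) i)

lemma integrable_gaussMat_entry {a b : ℕ} {f : ℝ → ℝ} (hf : Integrable f stdGauss)
    (i : Fin a) (μ : Fin b) :
    Integrable (fun z : Fin a → Fin b → ℝ => f (z i μ)) (gaussMat a b) :=
  (measurePreserving_gaussMat_eval i μ).integrable_comp_of_integrable hf

lemma integrable_gaussMat_sum {a b : ℕ} {f : ℝ → ℝ} (hf : Integrable f stdGauss) :
    Integrable (fun z : Fin a → Fin b → ℝ => ∑ i, ∑ μ, f (z i μ)) (gaussMat a b) :=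
  integrable_finsetSum _ fun i _ => integrable_finsetSum _ fun μ _ =>
    integrable_gaussMat_entry hf i μ

lemma integral_gaussMat_sum {a b : ℕ} {f : ℝ → ℝ} (hf : Integrable f stdGauss) :
    ∫ z : Fin a → Fin b → ℝ, ∑ i, ∑ μ, f (z i μ) ∂gaussMat a b
      = a * b * ∫ x, f x ∂stdGauss := by
  rw [integral_finsetSum _ fun i _ => integrable_finsetSum _ fun μ _ =>
    integrable_gaussMat_entry hf i μ]
  have h : ∀ (i : Fin a) (μ : Fin b),
      ∫ z : Fin a → Fin b → ℝ, f (z i μ) ∂gaussMat a b = ∫ x, f x ∂stdGauss := by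
    intro i μ
    have hmp := measurePreserving_gaussMat_eval i μ
    rw [← hmp.map_eq, integral_map hmp.measurable.aemeasurable
      (by rw [hmp.map_eq]; exact hf.aestronglyMeasurable)]
  calc _ = ∑ _i : Fin a, ∑ _μ : Fin b, ∫ x, f x ∂stdGauss := by
        refine Finset.sum_congr rfl fun i _ => ?_
        rw [integral_finsetSum _ fun μ _ => integrable_gaussMat_entry hf i μ]
        exact Finset.sum_congr rfl fun μ _ => h i μ
    _ = _ := by simp; ring

lemma one_sub_truncNorm_eq (c : ℝ) :
    1 - truncNorm c = ∫ x in {x : ℝ | |x| ≤ c}ᶜ, x ^ 2 ∂stdGauss := by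
  have hms : MeasurableSet {x : ℝ | |x| ≤ c} := measurableSet_le measurable_id.abs measurable_const
  rw [← integral_sq_stdGauss, ← integral_add_compl hms
    (by simpa using integrable_even_pow_stdGauss 1), truncNorm, add_sub_cancel_left]

lemma truncNorm_le_one (c : ℝ) : truncNorm c ≤ 1 := by
  rw [← sub_nonneg, one_sub_truncNorm_eq]
  exact integral_nonneg fun x => sq_nonneg x

lemma one_sub_truncNorm_le (p : ℕ) {c : ℝ} (hc : 0 < c) :
    1 - truncNorm c ≤ (∫ x, x ^ (2 * (p + 1)) ∂stdGauss) / c ^ (2 * p) := by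
  have hint := (integrable_even_pow_stdGauss (p + 1)).div_const (c ^ (2 * p))
  have hms : MeasurableSet {x : ℝ | |x| ≤ c} := measurableSet_le measurable_id.abs measurable_const
  rw [one_sub_truncNorm_eq, ← integral_div]
  calc _ ≤ ∫ x in {x : ℝ | |x| ≤ c}ᶜ, x ^ (2 * (p + 1)) / c ^ (2 * p) ∂stdGauss := by
        refine setIntegral_mono_on (by simpa using (integrable_even_pow_stdGauss 1).integrableOn)
          hint.integrableOn hms.compl fun x hx => ?_
        have hx : c < |x| := not_le.1 hx
        rw [le_div_iff₀ (by positivity), show 2 * (p + 1) = 2 + 2 * p by ring, pow_add]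
        refine mul_le_mul_of_nonneg_left ?_ (sq_nonneg x)
        rw [pow_mul, pow_mul, ← sq_abs x]
        gcongr
    _ ≤ _ := setIntegral_le_integral hint (ae_of_all _ fun x => by
        simp only [Pi.zero_apply]
        rw [pow_mul]
        positivity)

end GaussianMoments

lemma integral_abs_average_lnEps_trunc_sub_le {φ : ℝ → ℝ} {n m : ℕ} {K e : ℝ} (y : Fin m → ℝ)
    (p : ℕ) {c : ℝ} (hc : 1 ≤ c)
    (hs : (∫ x, x ^ (2 * (p + 1)) ∂stdGauss) / c ^ (2 * p) ≤ 1 / 2)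
    (hn : 1 ≤ n) (he : 0 < e) (he1 : e ≤ 1) (hen : e⁻¹ ≤ n)
    (hK1 : ∀ x, |x * deriv φ x| ≤ K) (hK2 : ∀ x, |deriv (deriv φ) x| ≤ K) :
    ∫ z, |1 / (n : ℝ) * ∑ i, lnEps e (eigs (Hmat φ n y z) i) -
        1 / (n : ℝ) * ∑ i, lnEps e (eigs (Hmat φ n y fun i μ => trunc c (z i μ)) i)|
          ∂gaussMat (n - 1) m ≤
      (20 * K * n ^ 3 * (m + 1) * (1 + n * m) +
        (2 * n + 12 * K * n ^ 2 * (m + 1)) * (2 * (n * m)) * (n * m)) *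
          ((∫ x, x ^ (2 * (p + 1)) ∂stdGauss) / c ^ (2 * p)) := by
  have hK0 : 0 ≤ K := (abs_nonneg _).trans (hK2 0)
  have hc0 : 0 < c := by linarith
  have hn1 : ((n - 1 : ℕ) : ℝ) ≤ n := by exact_mod_cast Nat.sub_le n 1
  have htr := one_sub_truncNorm_le p hc0
  have htr1 := truncNorm_le_one c
  have hi2 : Integrable (fun x : ℝ => x ^ 2) stdGauss := by
    simpa using integrable_even_pow_stdGauss 1
  have hip := (integrable_even_pow_stdGauss (p + 1)).div_const (c ^ (2 * p))
  have hS2 : Integrable (fun z : Fin (n - 1) → Fin m → ℝ => ∑ i, ∑ μ, z i μ ^ 2)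
      (gaussMat (n - 1) m) := integrable_gaussMat_sum (f := fun x => x ^ 2) hi2
  have hI1 : Integrable (fun z : Fin (n - 1) → Fin m → ℝ => 1 + ∑ i, ∑ μ, z i μ ^ 2)
      (gaussMat (n - 1) m) := (integrable_const (1 : ℝ)).add hS2
  have hI2 := integrable_gaussMat_sum (a := n - 1) (b := m)
    (f := fun x => x ^ (2 * (p + 1)) / c ^ (2 * p)) hip
  set q := (∫ x, x ^ (2 * (p + 1)) ∂stdGauss) / c ^ (2 * p) with hq
  have hq0 : 0 ≤ q := by linarith
  set A := (1 - truncNorm c) * (20 * K * n ^ 3 * (m + 1)) with hA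
  set B := (2 * n + 12 * K * (n : ℝ) ^ 2 * (m + 1)) * (2 * (n * m)) with hB
  have hbound : ∀ z : Fin (n - 1) → Fin m → ℝ, _ ≤ _ :=
    abs_average_lnEps_trunc_sub_le y p hc (by linarith) htr1 hn he he1 hen hK1 hK2
  have hI : Integrable (fun z : Fin (n - 1) → Fin m → ℝ => A * (1 + ∑ i, ∑ μ, z i μ ^ 2) +
      B * ∑ i, ∑ μ, z i μ ^ (2 * (p + 1)) / c ^ (2 * p)) (gaussMat (n - 1) m) :=
    (hI1.const_mul A).add (hI2.const_mul B)
  have hval : ∫ z : Fin (n - 1) → Fin m → ℝ, A * (1 + ∑ i, ∑ μ, z i μ ^ 2) +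
      B * ∑ i, ∑ μ, z i μ ^ (2 * (p + 1)) / c ^ (2 * p) ∂gaussMat (n - 1) m =
      A * (1 + (n - 1 : ℕ) * m) + B * ((n - 1 : ℕ) * m * q) := by
    rw [integral_add (hI1.const_mul A) (hI2.const_mul B), integral_const_mul, integral_const_mul,
      integral_add (integrable_const (1 : ℝ)) hS2, integral_gaussMat_sum (f := fun x => x ^ 2) hi2,
      integral_gaussMat_sum (f := fun x => x ^ (2 * (p + 1)) / c ^ (2 * p)) hip, integral_sq_stdGauss, integral_div, ← hq]
    simp only [integral_const, probReal_univ, smul_eq_mul, mul_one]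
  refine (integral_mono_of_nonneg (ae_of_all _ fun z => abs_nonneg _) hI
    (ae_of_all _ hbound)).trans ?_
  rw [hval, hA, hB]
  calc _ ≤ q * (20 * K * n ^ 3 * (m + 1)) * (1 + n * m) +
        (2 * n + 12 * K * n ^ 2 * (m + 1)) * (2 * (n * m)) * (n * m * q) := by
        gcongr
    _ = _ := by ring

theorem truncation_renormalization
    (φ : ℝ → ℝ) (hφ : ContDiff ℝ 3 φ)
    (hbd : ∃ K : ℝ, ∀ x : ℝ, |x * deriv φ x| ≤ K ∧ |deriv (deriv φ) x| ≤ K)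
    (α : ℝ) (hα : 1 < α)
    (m : ℕ → ℕ) (hm : Tendsto (fun n => (m n : ℝ) / n) atTop (𝓝 α))
    (γ δ : ℝ) (hγ : γ ∈ Ioo (0 : ℝ) (1 / 2)) (hδ : δ ∈ Ioo (0 : ℝ) 1)
    (hγδ : γ + 2 * δ < 1) :
    ∀ ε > (0 : ℝ), ∀ᶠ n : ℕ in atTop, ∀ y : Fin (m n) → ℝ,
      (∫ z, |(1 / (n : ℝ)) * ∑ i, lnEps ((n : ℝ) ^ (-δ)) (eigs (Hmat φ n y z) i) -
          (1 / (n : ℝ)) * ∑ i, lnEps ((n : ℝ) ^ (-δ))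
            (eigs (Hmat φ n y (fun i μ => trunc ((n : ℝ) ^ (γ / 2)) (z i μ))) i)|
        ∂(gaussMat (n - 1) (m n))) < ε := by
  intro ε hε
  obtain ⟨K, hK⟩ := hbd
  have hK0 : 0 ≤ K := (abs_nonneg _).trans (hK 0).1
  obtain ⟨hγ0, -⟩ := hγ
  obtain ⟨hδ0, hδ1⟩ := hδ
  obtain ⟨p, hp⟩ := exists_nat_ge (8 / γ)
  have hp8 : 8 ≤ γ * p := by rwa [div_le_iff₀' hγ0] at hp
  set M : ℝ := ∫ x, x ^ (2 * (p + 1)) ∂stdGauss with hM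
  have hM0 : 0 ≤ M := integral_nonneg fun x => by
    simp only [Pi.zero_apply]
    rw [pow_mul]
    positivity
  set β : ℝ := α + 1 with hβ
  have hβ1 : 1 ≤ β := by linarith
  set C : ℝ := (20 * K * (2 * β) * (2 * β) + (2 + 12 * K * (2 * β)) * (2 * β) * β) * M with hC
  have hlim : ∀ A : ℝ, Tendsto (fun n : ℕ => A / (n : ℝ)) atTop (𝓝 0) := fun A =>
    tendsto_const_div_atTop_nhds_zero_nat A
  filter_upwards [hm.eventually_lt_const (show α < β by linarith), eventually_ge_atTop 1,
    (hlim C).eventually_lt_const hε, (hlim M).eventually_lt_const (show (0 : ℝ) < 1 / 2 by norm_num)]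
    with n hmn hn hCn hMn y
  have hn1 : (1 : ℝ) ≤ n := by exact_mod_cast hn
  have hn0 : (0 : ℝ) < n := by linarith
  have hmβ : (m n : ℝ) ≤ β * n := by
    rw [div_lt_iff₀ hn0] at hmn
    exact hmn.le
  have hcpow : (n : ℝ) ^ 8 ≤ ((n : ℝ) ^ (γ / 2)) ^ (2 * p) := by
    rw [← Real.rpow_natCast (n : ℝ) 8, ← Real.rpow_natCast _ (2 * p), ← Real.rpow_mul hn0.le]
    refine Real.rpow_le_rpow_of_exponent_le hn1 ?_
    push_cast
    linarith
  have hq : M / ((n : ℝ) ^ (γ / 2)) ^ (2 * p) ≤ M / (n : ℝ) ^ 8 := by gcongr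
  have hq2 : M / (n : ℝ) ^ 8 ≤ M / n := by
    gcongr
    exact le_self_pow₀ hn1 (by norm_num)
  have hδn : ((n : ℝ) ^ (-δ))⁻¹ ≤ n := by
    rw [Real.rpow_neg hn0.le, inv_inv]
    simpa using Real.rpow_le_rpow_of_exponent_le hn1 hδ1.le
  refine (integral_abs_average_lnEps_trunc_sub_le y p (K := K) (Real.one_le_rpow hn1 (by positivity))
    (by linarith) hn (by positivity) (Real.rpow_le_one_of_one_le_of_nonpos hn1 (by linarith)) hδn
    (fun x => (hK x).1) (fun x => (hK x).2)).trans_lt (lt_of_le_of_lt ?_ hCn)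
  have hm1 : (m n : ℝ) + 1 ≤ 2 * β * n := by nlinarith
  have hnm : (n : ℝ) * m n ≤ β * n ^ 2 := by nlinarith
  have hnm1 : 1 + (n : ℝ) * m n ≤ 2 * β * n ^ 2 := by nlinarith
  calc _ ≤ (20 * K * n ^ 3 * (2 * β * n) * (2 * β * n ^ 2) +
        (2 * n ^ 3 + 12 * K * n ^ 2 * (2 * β * n)) * (2 * (β * n ^ 2)) * (β * n ^ 2)) *
          (M / (n : ℝ) ^ 8) := by
        gcongr
        exact le_self_pow₀ hn1 (by norm_num)
    _ ≤ (20 * K * n ^ 3 * (2 * β * n) * (2 * β * n ^ 2) * n +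
        (2 * n ^ 3 + 12 * K * n ^ 2 * (2 * β * n)) * (2 * (β * n ^ 2)) * (β * n ^ 2)) *
          (M / (n : ℝ) ^ 8) := by
        refine mul_le_mul_of_nonneg_right (add_le_add ?_ le_rfl) (by positivity)
        exact le_mul_of_one_le_right (by positivity) hn1
    _ = C / n := by
        rw [hC]
        field_simp
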